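/- If G is an isolate-free graph, then FTD(G) ≥ dom(G)/2, where dom(G) is the domatic number of G. -/

import Mathlib

/-- The number of members of the family `F` (counted with multiplicity) containing `v`. -/
def appearCount {V : Type*} [DecidableEq V] (F : Multiset (Finset V)) (v : V) : ℕ :=
  Multiset.countP (fun S => v ∈ S) F

/-- `r_F`: the maximum, over all vertices `v`, of the number of members of `F` containing `v`. -/
def maxAppear {V : Type*} [Fintype V] [DecidableEq V] (F : Multiset (Finset V)) : ℕ :=
  Finset.univ.sup fun v : V => appearCount F v

/-- `S` is a total dominating set of `G`: every vertex of `G` has a neighbor in `S`. -/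
def IsTotalDomSet {V : Type*} (G : SimpleGraph V) (S : Finset V) : Prop :=
  ∀ v : V, ∃ u ∈ S, G.Adj v u

/-- The fractional total domatic number `FTD(G)`: the supremum of the effective ratio
`|F| / r_F` over all nonempty thoroughly distributed families `F` of `G`, i.e. finite
families (with repetition allowed) of total dominating sets of `G`. -/
noncomputable def FTD {V : Type*} [Fintype V] [DecidableEq V] (G : SimpleGraph V) : ℝ :=
  sSup { r : ℝ | ∃ F : Multiset (Finset V), F ≠ 0 ∧ (∀ S ∈ F, IsTotalDomSet G S) ∧
      r = (Multiset.card F : ℝ) / (maxAppear F : ℝ) }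

/-- `S` is a dominating set of `G`: every vertex not in `S` has a neighbor in `S`. -/
def IsDomSet {V : Type*} (G : SimpleGraph V) (S : Finset V) : Prop :=
  ∀ v : V, v ∉ S → ∃ u ∈ S, G.Adj v u

/-- The domatic number: the maximum number of pairwise disjoint dominating sets. -/
noncomputable def domNum {V : Type*} [Fintype V] [DecidableEq V] (G : SimpleGraph V) : ℕ :=
  sSup { k : ℕ | ∃ f : Fin k → Finset V, (∀ i, IsDomSet G (f i)) ∧
      ∀ i j, i ≠ j → Disjoint (f i) (f j) }

theorem card_le_sum_appear {V : Type*} [Fintype V] [DecidableEq V]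
    (F : Multiset (Finset V)) (h : ∀ S ∈ F, S.Nonempty) :
    Multiset.card F ≤ ∑ v : V, appearCount F v := by
  induction F using Multiset.induction_on with
  | empty => simp
  | cons S F ih =>
    have h1 := ih (fun T hT => h T (Multiset.mem_cons_of_mem hT))
    have h2 : 1 ≤ S.card := (h S (Multiset.mem_cons_self S F)).card_pos
    have h3 : ∑ v : V, appearCount (S ::ₘ F) v = ∑ v : V, appearCount F v + S.card := by
      simp [appearCount, Multiset.countP_cons, Finset.sum_add_distrib]
    rw [h3, Multiset.card_cons]
    omega

theorem card_le_mul_maxAppear {V : Type*} [Fintype V] [DecidableEq V]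
    (F : Multiset (Finset V)) (h : ∀ S ∈ F, S.Nonempty) :
    Multiset.card F ≤ Fintype.card V * maxAppear F := by
  refine (card_le_sum_appear F h).trans ?_
  have := Finset.sum_le_card_nsmul (Finset.univ : Finset V) (fun v => appearCount F v)
    (maxAppear F) (fun v hv => Finset.le_sup (f := fun v : V => appearCount F v) hv)
  simpa using this

theorem le_FTD {V : Type*} [Fintype V] [DecidableEq V] [Nonempty V] (G : SimpleGraph V)
    (F : Multiset (Finset V)) (hF : F ≠ 0) (h : ∀ S ∈ F, IsTotalDomSet G S) (m : ℕ)
    (hm : ∀ v, appearCount F v ≤ m) : (Multiset.card F : ℝ) / m ≤ FTD G := by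
  have hne : ∀ S, IsTotalDomSet G S → S.Nonempty := fun S hS => by
    obtain ⟨u, hu, _⟩ := hS (Classical.arbitrary V)
    exact ⟨u, hu⟩
  have hpos : 0 < maxAppear F := by
    have h1 := card_le_mul_maxAppear F (fun S hS => hne S (h S hS))
    have h2 := Multiset.card_pos.2 hF
    exact Nat.pos_of_ne_zero (fun h0 => by rw [h0] at h1; omega)
  have hle : maxAppear F ≤ m := Finset.sup_le (fun v _ => hm v)
  have h1 : (Multiset.card F : ℝ) / m ≤ (Multiset.card F : ℝ) / (maxAppear F : ℝ) := by
    have : (0 : ℝ) < maxAppear F := by exact_mod_cast hpos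
    have : (maxAppear F : ℝ) ≤ m := by exact_mod_cast hle
    gcongr
  refine h1.trans (le_csSup ⟨Fintype.card V, ?_⟩ ⟨F, hF, h, rfl⟩)
  rintro r ⟨F', _, h', rfl⟩
  have h2 := card_le_mul_maxAppear F' (fun S hS => hne S (h' S hS))
  apply div_le_of_le_mul₀ (by positivity) (by positivity)
  exact_mod_cast h2

theorem domNum_mem {V : Type*} [Fintype V] [DecidableEq V] (G : SimpleGraph V)
    (h : domNum G ≠ 0) : ∃ f : Fin (domNum G) → Finset V, (∀ i, IsDomSet G (f i)) ∧
      ∀ i j, i ≠ j → Disjoint (f i) (f j) := by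
  by_cases hb : BddAbove { k : ℕ | ∃ f : Fin k → Finset V, (∀ i, IsDomSet G (f i)) ∧
      ∀ i j, i ≠ j → Disjoint (f i) (f j) }
  · have key := fun hne => Nat.sSup_mem hne hb
    exact key ⟨0, fun i => i.elim0, fun i => i.elim0, fun i => i.elim0⟩
  · exact absurd ((csSup_of_not_bddAbove hb).trans (by simp)) h

theorem pair_bound {V : Type*} [Fintype V] [DecidableEq V] [Nonempty V] (G : SimpleGraph V)
    (m : ℕ) (f : Fin (m + 2) → Finset V) (hd : ∀ i, IsDomSet G (f i))
    (hj : ∀ i j, i ≠ j → Disjoint (f i) (f j)) : ((m + 2 : ℕ) : ℝ) / 2 ≤ FTD G := by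
  have key := le_FTD G
    ((Finset.univ : Finset (Fin (m + 2))).val.map (fun i => f i ∪ f (i + 1))) ?_ ?_ 2 ?_
  · rw [Multiset.card_map, Finset.card_val, Finset.card_univ, Fintype.card_fin] at key
    exact_mod_cast key
  · intro h0
    have := congrArg Multiset.card h0
    simp at this
  · intro S hS v
    obtain ⟨i, _, rfl⟩ := Multiset.mem_map.1 hS
    by_cases hv : v ∈ f i
    · have hne : i ≠ i + 1 := by simp
      obtain ⟨u, hu, ha⟩ := hd (i + 1) v (Finset.disjoint_left.1 (hj _ _ hne) hv)
      exact ⟨u, Finset.mem_union_right _ hu, ha⟩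
    · obtain ⟨u, hu, ha⟩ := hd i v hv
      exact ⟨u, Finset.mem_union_left _ hu, ha⟩
  · intro v
    have huniq : ∀ i j, v ∈ f i → v ∈ f j → i = j := fun i j hi hj' => by
      by_contra hne
      exact Finset.disjoint_left.1 (hj i j hne) hi hj'
    have h1 : (Finset.univ.filter (fun i => v ∈ f i)).card ≤ 1 :=
      Finset.card_le_one.2 fun a ha b hb =>
        huniq a b (Finset.mem_filter.1 ha).2 (Finset.mem_filter.1 hb).2
    have h2 : (Finset.univ.filter (fun i => v ∈ f (i + 1))).card ≤ 1 :=
      Finset.card_le_one.2 fun a ha b hb =>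
        add_right_cancel (huniq _ _ (Finset.mem_filter.1 ha).2 (Finset.mem_filter.1 hb).2)
    have h3 : appearCount (Finset.univ.val.map (fun i => f i ∪ f (i + 1))) v
        = (Finset.univ.filter (fun i => v ∈ f i ∪ f (i + 1))).card := by
      rw [appearCount, Multiset.countP_map]
      rfl
    rw [h3]
    simp only [Finset.mem_union, Finset.filter_or]
    exact (Finset.card_union_le _ _).trans (by omega)

theorem stmt5 {V : Type*} [Fintype V] [DecidableEq V] (G : SimpleGraph V)
    (hG : ∀ v : V, ∃ u : V, G.Adj v u) :
    (domNum G : ℝ) / 2 ≤ FTD G := by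
  rcases isEmpty_or_nonempty V with hV | hV
  · have h0 : domNum G = 0 := by
      refine (csSup_of_not_bddAbove ?_).trans (by simp)
      rintro ⟨b, hb⟩
      have := hb (a := b + 1) ⟨fun _ => ∅, fun _ v => hV.elim v, fun _ _ _ => by simp⟩
      omega
    rw [h0]
    simp only [Nat.cast_zero, zero_div]
    apply Real.sSup_nonneg
    rintro r ⟨F, _, _, rfl⟩
    positivity
  · by_cases h2 : 2 ≤ domNum G
    · have hmem := domNum_mem G (by omega)
      obtain ⟨m, hm⟩ : ∃ m, domNum G = m + 2 := ⟨domNum G - 2, by omega⟩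
      rw [hm] at hmem ⊢
      obtain ⟨f, hd, hj⟩ := hmem
      exact pair_bound G m f hd hj
    · have h1 := le_FTD G {Finset.univ} (by simp)
        (fun S hS v => by
          rw [Multiset.mem_singleton.1 hS]
          obtain ⟨u, hu⟩ := hG v
          exact ⟨u, Finset.mem_univ u, hu⟩) 1
        (fun v => (Multiset.countP_le_card _ _).trans (by simp))
      have h3 : (domNum G : ℝ) ≤ 1 := by exact_mod_cast (by omega : domNum G ≤ 1)
      simp at h1
      linarith
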